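/- arXiv:1907.03170 — 2 statements merged into one kernel-verified Lean document; each statement's English description precedes it below -/
import Mathlib

section
/- Let X be an n×p real matrix, y ∈ ℝⁿ, and c > 0. Then for every p×p real matrix G that is a generalized inverse of XᵀX (i.e., (XᵀX) G (XᵀX) = XᵀX), one has ‖(c I_p + XᵀX)⁻¹ Xᵀ y‖ ≤ ‖G Xᵀ y‖, where ‖·‖ is the Euclidean norm on ℝᵖ and I_p is the p×p identity matrix. -/
open Matrix

/-- The Euclidean norm of a real vector. -/
noncomputable def euclNorm {ι : Type*} [Fintype ι] (v : ι → ℝ) : ℝ :=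
  Real.sqrt (∑ i, (v i) ^ 2)

/-- If `A * G * A = A` for the Gram matrix `A = Xᵀ * X`, then `G` solves the normal equations. -/
theorem gram_mul_gInv_mul_transpose {m n : Type*} [Fintype m] [Fintype n]
    (X : Matrix m n ℝ) (G : Matrix n n ℝ) (hG : (Xᵀ * X) * G * (Xᵀ * X) = Xᵀ * X) :
    (Xᵀ * X) * G * Xᵀ = Xᵀ := by
  classical
  have h := Matrix.mul_conjTranspose_mul_self_eq_zero X ((Xᵀ * X) * G - 1)
  simp only [conjTranspose_eq_transpose_of_trivial, Matrix.sub_mul, Matrix.one_mul,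
    sub_eq_zero] at h
  exact h.mp hG

/-- The ridge solution is no longer than any solution of the unregularized system. -/
theorem euclNorm_le_of_smul_add_mulVec_eq {n : Type*} [Fintype n] {A : Matrix n n ℝ}
    (hA : A.PosSemidef) {c : ℝ} (hc : 0 < c) {r w : n → ℝ} (h : c • r + A *ᵥ r = A *ᵥ w) :
    euclNorm r ≤ euclNorm w := by
  have hAd : A *ᵥ (w - r) = c • r := by rw [mulVec_sub, ← h, add_sub_cancel_right]
  have hd : 0 ≤ (w - r) ⬝ᵥ r := by
    have hpos := hA.dotProduct_mulVec_nonneg (w - r)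
    rw [hAd, star_trivial, dotProduct_smul, smul_eq_mul] at hpos
    exact nonneg_of_mul_nonneg_right hpos hc
  refine Real.sqrt_le_sqrt ?_
  have hsum : ∑ i, w i ^ 2 =
      ∑ i, r i ^ 2 + 2 * ((w - r) ⬝ᵥ r) + ∑ i, (w i - r i) ^ 2 := by
    simp only [dotProduct, Finset.mul_sum, ← Finset.sum_add_distrib, Pi.sub_apply]
    exact Finset.sum_congr rfl fun i _ => by ring
  have hsq : 0 ≤ ∑ i, (w i - r i) ^ 2 := Finset.sum_nonneg fun i _ => sq_nonneg _
  linarith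

/-- Ridge-regularized least squares coefficients are no larger in Euclidean norm than
least squares coefficients obtained from any generalized inverse of `XᵀX`. -/
theorem norm_ridge_le_norm_gInv_leastSquares
    {n p : ℕ} (X : Matrix (Fin n) (Fin p) ℝ) (y : Fin n → ℝ) (c : ℝ) (hc : 0 < c)
    (G : Matrix (Fin p) (Fin p) ℝ)
    (hG : (Xᵀ * X) * G * (Xᵀ * X) = Xᵀ * X) :
    euclNorm ((c • (1 : Matrix (Fin p) (Fin p) ℝ) + Xᵀ * X)⁻¹ *ᵥ (Xᵀ *ᵥ y)) ≤
      euclNorm (G *ᵥ (Xᵀ *ᵥ y)) := by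
  have hA : (Xᵀ * X).PosSemidef := by
    simpa only [conjTranspose_eq_transpose_of_trivial] using
      posSemidef_conjTranspose_mul_self X
  have hunit : IsUnit (c • (1 : Matrix (Fin p) (Fin p) ℝ) + Xᵀ * X).det :=
    (isUnit_iff_isUnit_det _).mp ((PosDef.one.smul hc).add_posSemidef hA).isUnit
  refine euclNorm_le_of_smul_add_mulVec_eq hA hc ?_
  set r := (c • (1 : Matrix (Fin p) (Fin p) ℝ) + Xᵀ * X)⁻¹ *ᵥ (Xᵀ *ᵥ y) with hr
  calc c • r + (Xᵀ * X) *ᵥ r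
      = (c • (1 : Matrix (Fin p) (Fin p) ℝ) + Xᵀ * X) *ᵥ r := by
        rw [add_mulVec, smul_mulVec, one_mulVec]
    _ = Xᵀ *ᵥ y := by rw [hr, mulVec_mulVec, mul_nonsing_inv _ hunit, one_mulVec]
    _ = (Xᵀ * X) *ᵥ (G *ᵥ (Xᵀ *ᵥ y)) := by
        rw [mulVec_mulVec, mulVec_mulVec, gram_mul_gInv_mul_transpose X G hG]
end

section
/- Let Z ∈ ℝ^{n×qr} have full column rank, let C be a qr²×qr² real symmetric positive definite matrix, and let Σ be an r×r real symmetric positive definite matrix. Then tr( (I_r ⊗ Z) (C + Σ⁻¹ ⊗ ZᵀZ)⁻¹ (I_r ⊗ Z)ᵀ ) ≤ q r · tr(Σ). -/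
open Matrix Kronecker

/-- Matrix inversion is antitone: `(C + B)⁻¹ ≤ B⁻¹` for positive definite `B` and `C`. -/
theorem Matrix.PosDef.posSemidef_inv_sub_inv_add {m : Type*} [Fintype m] [DecidableEq m]
    {B C : Matrix m m ℝ} (hB : B.PosDef) (hC : C.PosDef) :
    (B⁻¹ - (C + B)⁻¹).PosSemidef := by
  have hA := hC.add hB
  have hBu := (isUnit_iff_isUnit_det _).1 hB.isUnit
  have hAu := (isUnit_iff_isUnit_det _).1 hA.isUnit
  have key : B⁻¹ - (C + B)⁻¹ = (C + B)⁻¹ * (C + C * B⁻¹ * Cᴴ) * ((C + B)⁻¹)ᴴ := by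
    rw [hA.inv.isHermitian.eq, hC.isHermitian.eq]
    have h : C + C * B⁻¹ * C = (C + B) * (B⁻¹ - (C + B)⁻¹) * (C + B) := by
      rw [mul_sub, sub_mul, Matrix.mul_nonsing_inv _ hAu, one_mul]
      simp only [add_mul, mul_add, Matrix.mul_nonsing_inv _ hBu, mul_assoc,
        Matrix.nonsing_inv_mul _ hBu, one_mul, mul_one]
      abel
    rw [h, ← mul_assoc, ← mul_assoc, Matrix.nonsing_inv_mul _ hAu, one_mul, mul_assoc,
      Matrix.mul_nonsing_inv _ hAu, mul_one]
  rw [key]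
  exact (hC.posSemidef.add
    (hB.inv.posSemidef.mul_mul_conjTranspose_same C)).mul_mul_conjTranspose_same _

/-- The Gram matrix of a real matrix of full column rank is positive definite. -/
theorem Matrix.posDef_transpose_mul_self_of_rank_eq_card {m n : Type*} [Fintype m] [Fintype n]
    {Z : Matrix m n ℝ} (hZ : Z.rank = Fintype.card n) : (Zᵀ * Z).PosDef := by
  classical
  rw [← conjTranspose_eq_transpose_of_trivial]
  refine .conjTranspose_mul_self _ (mulVec_injective_iff.2 ?_)
  rw [linearIndependent_iff_card_eq_finrank_span, ← hZ, rank_eq_finrank_span_cols]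
  rfl

/-- For `Z` of full column rank and SPD `C` and `Σ`,
`tr((I_r ⊗ Z)(C + Σ⁻¹ ⊗ ZᵀZ)⁻¹(I_r ⊗ Z)ᵀ) ≤ qr · tr(Σ)`. -/
theorem trace_kron_inv_le {n r q : ℕ}
    (Z : Matrix (Fin n) (Fin (q * r)) ℝ) (hZ : Z.rank = q * r)
    (C : Matrix (Fin r × Fin (q * r)) (Fin r × Fin (q * r)) ℝ) (hC : C.PosDef)
    (S : Matrix (Fin r) (Fin r) ℝ) (hS : S.PosDef) :
    (((1 : Matrix (Fin r) (Fin r) ℝ) ⊗ₖ Z) * (C + S⁻¹ ⊗ₖ (Zᵀ * Z))⁻¹ *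
        ((1 : Matrix (Fin r) (Fin r) ℝ) ⊗ₖ Z)ᵀ).trace ≤
      (q * r : ℝ) * S.trace := by
  have hG : (Zᵀ * Z).PosDef := posDef_transpose_mul_self_of_rank_eq_card (by simpa using hZ)
  have hGu := (isUnit_iff_isUnit_det _).1 hG.isUnit
  have hSu := (isUnit_iff_isUnit_det _).1 hS.isUnit
  have h := (((hS.inv.kronecker hG).posSemidef_inv_sub_inv_add hC).mul_mul_conjTranspose_same
    ((1 : Matrix (Fin r) (Fin r) ℝ) ⊗ₖ Z)).trace_nonneg
  rw [Matrix.mul_sub, Matrix.sub_mul, trace_sub, sub_nonneg,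
    conjTranspose_eq_transpose_of_trivial] at h
  refine h.trans_eq ?_
  rw [inv_kronecker, nonsing_inv_nonsing_inv _ hSu, ← kroneckerMap_transpose, transpose_one,
    ← mul_kronecker_mul, ← mul_kronecker_mul, Matrix.one_mul, Matrix.mul_one, trace_kronecker,
    trace_mul_cycle Z, mul_nonsing_inv _ hGu, trace_one, Fintype.card_fin, Nat.cast_mul, mul_comm]
end
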